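/- There is no L2-formula φ(x) with one free variable such that for every n, every permutation σ of {1,…,n} and every a ∈ {1,…,n}, φ(a) holds in M_σ if and only if a is a fixed point of σ (i.e., σ(a) = a). -/

import Mathlib

open FirstOrder

/-- Relation symbols of the language `L2` (TOTO): two binary relation symbols `<P` and `<V`. -/
inductive TwoOrderRel : ℕ → Type
  | ltP : TwoOrderRel 2
  | ltV : TwoOrderRel 2

/-- The first-order language `L2` with exactly two binary relation symbols `<P` and `<V`. -/
def L2 : FirstOrder.Language := ⟨fun _ => Empty, TwoOrderRel⟩

/-- The `L2`-structure `M_σ` associated to a permutation `σ` of `{1,…,n}`: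
the domain is `Fin n`, `i <P j` is interpreted as `i < j`, and `i <V j` as `σ i < σ j`. -/
def permStruc2 {n : ℕ} (σ : Equiv.Perm (Fin n)) : L2.Structure (Fin n) where
  funMap := fun {_} f _ => Empty.elim f
  RelMap
    | .ltP => fun x => x 0 < x 1
    | .ltV => fun x => σ (x 0) < σ (x 1)

/-- Satisfaction of an `L2`-sentence in the structure `M_σ`. -/
def Sat2 {n : ℕ} (σ : Equiv.Perm (Fin n)) (φ : L2.Sentence) : Prop :=
  letI := permStruc2 σ
  (Fin n) ⊨ φ

/-- Realization in `M_σ` of an `L2`-formula with free variables indexed by `α`,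
under the assignment `v`. -/
def Real2 {n : ℕ} {α : Type} (σ : Equiv.Perm (Fin n)) (φ : L2.Formula α)
    (v : α → Fin n) : Prop :=
  letI := permStruc2 σ
  φ.Realize v

/-- Differences agree up to threshold `K`. -/
def DSim (K a b : ℤ) : Prop := a = b ∨ (K ≤ a ∧ K ≤ b) ∨ (a ≤ -K ∧ b ≤ -K)

/-- Tuples of integers agree on differences up to threshold `K`. -/
def TSim {ι : Type} (K : ℤ) (f g : ι → ℤ) : Prop := ∀ i j, DSim K (f i - f j) (g i - g j)

theorem TSim.symm {ι : Type} {K : ℤ} {f g : ι → ℤ} (h : TSim K f g) : TSim K g f := by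
  intro i j
  have := h i j
  unfold DSim at *
  omega

theorem TSim.mono {ι : Type} {K K' : ℤ} {f g : ι → ℤ} (h : TSim K f g) (hK : K' ≤ K) :
    TSim K' f g := by
  intro i j
  have := h i j
  unfold DSim at *
  omega

theorem TSim.extend {ι : Type} [Fintype ι] {K : ℤ} (hK : 1 ≤ K) {f g : ι → ℤ}
    (h : TSim (2 * K) f g) (c : ℤ) (lo hi : ι) (hlo : f lo ≤ c) (hhi : c ≤ f hi) :
    ∃ d : ℤ, ∀ i, DSim K (f i - c) (g i - d) := by
  classical
  obtain ⟨p, hp, hpm⟩ := Finset.exists_max_image (Finset.univ.filter (fun i => f i ≤ c)) f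
    ⟨lo, by simpa using hlo⟩
  obtain ⟨q, hq, hqm⟩ := Finset.exists_min_image (Finset.univ.filter (fun i => c ≤ f i)) f
    ⟨hi, by simpa using hhi⟩
  simp only [Finset.mem_filter, Finset.mem_univ, true_and] at hp hpm hq hqm
  have key : ∀ j, f j ≤ f p ∨ f q ≤ f j := by
    intro j
    rcases le_total (f j) c with h1 | h1
    · exact Or.inl (hpm j h1)
    · exact Or.inr (hqm j h1)
  have hpq := h p q
  unfold DSim at *
  by_cases h1 : c - f p < K
  · refine ⟨g p + (c - f p), fun j => ?_⟩
    have := h j p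
    unfold DSim at this
    omega
  by_cases h2 : f q - c < K
  · refine ⟨g q - (f q - c), fun j => ?_⟩
    have := h j q
    unfold DSim at this
    omega
  refine ⟨g p + K, fun j => ?_⟩
  have a1 := h j p
  have a2 := h j q
  have a3 := key j
  unfold DSim at a1 a2
  omega

/-- Tuple with end sentinels. -/
def extTuple {n l : ℕ} (v : Fin 1 → Fin n) (xs : Fin l → Fin n) :
    Bool ⊕ (Fin 1 ⊕ Fin l) → ℤ :=
  Sum.elim (fun b => if b then (n : ℤ) else -1) (fun t => ((Sum.elim v xs t : Fin n) : ℤ))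

/-- Realization in the reversal permutation. -/
def RevReal {n l : ℕ} (φ : L2.BoundedFormula (Fin 1) l) (v : Fin 1 → Fin n)
    (xs : Fin l → Fin n) : Prop :=
  letI := permStruc2 (Fin.revPerm : Equiv.Perm (Fin n))
  φ.Realize v xs

theorem ext_step {n m l : ℕ} {K : ℤ} (hK : 1 ≤ K) {v : Fin 1 → Fin n} {xs : Fin l → Fin n}
    {w : Fin 1 → Fin m} {ys : Fin l → Fin m}
    (h : TSim (2 * K) (extTuple v xs) (extTuple w ys)) (c : Fin n) :
    ∃ d : Fin m, TSim K (extTuple v (Fin.snoc xs c : Fin (l+1) → Fin n))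
      (extTuple w (Fin.snoc ys d : Fin (l+1) → Fin m)) := by
  obtain ⟨d, hd⟩ := h.extend hK (c : ℤ) (Sum.inl false) (Sum.inl true)
    (by simp only [extTuple, Sum.elim_inl, Bool.false_eq_true, if_false]; omega) (by simp [extTuple])
  have h0 := hd (Sum.inl false)
  have h1 := hd (Sum.inl true)
  simp only [extTuple, Sum.elim_inl, DSim, if_true, Bool.false_eq_true, if_false] at h0 h1
  have hc := c.2
  obtain ⟨e, rfl⟩ : ∃ e : Fin m, (e : ℤ) = d := by
    refine ⟨⟨d.toNat, by omega⟩, ?_⟩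
    simp only
    omega
  refine ⟨e, ?_⟩
  have hm : TSim K (extTuple v xs) (extTuple w ys) := h.mono (by omega)
  have look : ∀ i : Bool ⊕ (Fin 1 ⊕ Fin (l+1)),
      (∃ j, extTuple v (Fin.snoc xs c : Fin (l+1) → Fin n) i = extTuple v xs j ∧
        extTuple w (Fin.snoc ys e : Fin (l+1) → Fin m) i = extTuple w ys j) ∨
      (extTuple v (Fin.snoc xs c : Fin (l+1) → Fin n) i = (c : ℤ) ∧
        extTuple w (Fin.snoc ys e : Fin (l+1) → Fin m) i = (e : ℤ)) := by
    rintro (b | t | k)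
    · exact Or.inl ⟨Sum.inl b, rfl, rfl⟩
    · exact Or.inl ⟨Sum.inr (Sum.inl t), rfl, rfl⟩
    · refine Fin.lastCases ?_ (fun k => ?_) k
      · right; simp [extTuple]
      · left; exact ⟨Sum.inr (Sum.inr k), by simp [extTuple], by simp [extTuple]⟩
  intro i j
  rcases look i with ⟨i', e1, e2⟩ | ⟨e1, e2⟩ <;> rcases look j with ⟨j', e3, e4⟩ | ⟨e3, e4⟩ <;>
    rw [e1, e2, e3, e4]
  · exact hm i' j'
  · exact hd i'
  · have := hd j'
    unfold DSim at *
    omega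
  · left; omega

theorem term_var {l : ℕ} (t : L2.Term (Fin 1 ⊕ Fin l)) : ∃ s, t = FirstOrder.Language.Term.var s := by
  cases t with
  | var s => exact ⟨s, rfl⟩
  | func f _ => exact Empty.elim f

theorem main_ef {l : ℕ} (φ : L2.BoundedFormula (Fin 1) l) :
    ∃ K : ℕ, 1 ≤ K ∧ ∀ (n m : ℕ) (v : Fin 1 → Fin n) (xs : Fin l → Fin n)
      (w : Fin 1 → Fin m) (ys : Fin l → Fin m),
      TSim (K : ℤ) (extTuple v xs) (extTuple w ys) → (RevReal φ v xs ↔ RevReal φ w ys) := by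
  induction φ with
  | falsum => exact ⟨1, le_rfl, fun _ _ _ _ _ _ _ => Iff.rfl⟩
  | equal t₁ t₂ =>
    refine ⟨1, le_rfl, fun n m v xs w ys h => ?_⟩
    obtain ⟨s, rfl⟩ := term_var t₁
    obtain ⟨t, rfl⟩ := term_var t₂
    have := h (Sum.inr s) (Sum.inr t)
    simp only [extTuple, Sum.elim_inr, DSim] at this
    change Sum.elim v xs s = Sum.elim v xs t ↔ Sum.elim w ys s = Sum.elim w ys t
    rw [Fin.ext_iff, Fin.ext_iff]
    omega
  | rel R ts =>
    refine ⟨1, le_rfl, fun n m v xs w ys h => ?_⟩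
    cases R with
    | ltP =>
      obtain ⟨s, hs⟩ := term_var (ts 0)
      obtain ⟨t, ht⟩ := term_var (ts 1)
      have := h (Sum.inr s) (Sum.inr t)
      simp only [extTuple, Sum.elim_inr, DSim] at this
      letI := permStruc2 (Fin.revPerm : Equiv.Perm (Fin n))
      letI := permStruc2 (Fin.revPerm : Equiv.Perm (Fin m))
      change (ts 0).realize (Sum.elim v xs) < (ts 1).realize (Sum.elim v xs) ↔
        (ts 0).realize (Sum.elim w ys) < (ts 1).realize (Sum.elim w ys)
      rw [hs, ht]
      simp only [FirstOrder.Language.Term.realize_var, Fin.lt_def]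
      omega
    | ltV =>
      obtain ⟨s, hs⟩ := term_var (ts 0)
      obtain ⟨t, ht⟩ := term_var (ts 1)
      have := h (Sum.inr s) (Sum.inr t)
      simp only [extTuple, Sum.elim_inr, DSim] at this
      letI := permStruc2 (Fin.revPerm : Equiv.Perm (Fin n))
      letI := permStruc2 (Fin.revPerm : Equiv.Perm (Fin m))
      change Fin.rev ((ts 0).realize (Sum.elim v xs)) < Fin.rev ((ts 1).realize (Sum.elim v xs)) ↔
        Fin.rev ((ts 0).realize (Sum.elim w ys)) < Fin.rev ((ts 1).realize (Sum.elim w ys))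
      rw [hs, ht]
      simp only [FirstOrder.Language.Term.realize_var, Fin.lt_def, Fin.val_rev]
      omega
  | imp φ ψ ih1 ih2 =>
    obtain ⟨K1, h1, H1⟩ := ih1
    obtain ⟨K2, h2, H2⟩ := ih2
    refine ⟨K1 + K2, by omega, fun n m v xs w ys h => ?_⟩
    have a1 := H1 n m v xs w ys (h.mono (by push_cast; omega))
    have a2 := H2 n m v xs w ys (h.mono (by push_cast; omega))
    exact imp_congr a1 a2
  | all φ ih =>
    obtain ⟨K, h1, H⟩ := ih
    refine ⟨2 * K, by omega, fun n m v xs w ys h => ?_⟩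
    push_cast at h
    constructor
    · intro hA d
      obtain ⟨c, hc⟩ := ext_step (by exact_mod_cast h1) h.symm d
      exact (H _ _ _ _ _ _ hc).2 (hA c)
    · intro hA c
      obtain ⟨d, hd⟩ := ext_step (by exact_mod_cast h1) h c
      exact (H _ _ _ _ _ _ hd).2 (hA d)

theorem is_fixed_point_not_TOTO_expressible :
    ¬ ∃ φ : L2.Formula (Fin 1), ∀ (n : ℕ) (σ : Equiv.Perm (Fin n)) (a : Fin n),
        Real2 σ φ ![a] ↔ σ a = a := by
  rintro ⟨φ, hφ⟩
  obtain ⟨K, hK, H⟩ := main_ef φ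
  let a : Fin (2 * K + 1) := ⟨K, by omega⟩
  let b : Fin (2 * K + 1) := ⟨K + 1, by omega⟩
  have hs : TSim (K : ℤ) (extTuple ![a] (@default (Fin 0 → Fin (2 * K + 1)) Unique.instInhabited))
      (extTuple ![b] (@default (Fin 0 → Fin (2 * K + 1)) Unique.instInhabited)) := by
    rintro (i | i | i) (j | j | j)
    · left; rfl
    · cases i <;> simp [extTuple, DSim, a, b] <;> omega
    · exact j.elim0
    · cases j <;> simp [extTuple, DSim, a, b] <;> omega
    · left; simp [extTuple]
    · exact j.elim0
    all_goals exact i.elim0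
  have e : Real2 Fin.revPerm φ ![a] ↔ Real2 Fin.revPerm φ ![b] := H _ _ _ _ _ _ hs
  rw [hφ, hφ] at e
  simp only [Fin.revPerm_apply, Fin.ext_iff, Fin.val_rev, a, b] at e
  omega
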